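/- Let C be an additive category and f : X1 → X2 a morphism in C. Then in H(C): (1) the composable pair 0 → (0 → X1) → (0 → X2) ⊕ (X1 →1 X1) → (X1 →f X2) → 0, whose inflation has components (0, [f, −1]^t) and whose deflation has components (1_{X1}, [1, f]), is a componentwise split kernel–cokernel pair; and (2) the composable pair 0 → (X1 →f X2) → (X2 →1 X2) ⊕ (X1 → 0) → (X2 → 0) → 0, whose inflation has components ([f, 1]^t, 1_{X2}) and whose deflation has components ([−1, f], 0), is a componentwise split kernel–cokernel pair. -/

import Mathlib

/-!
STATEMENT 2: For any morphism f : X1 ⟶ X2 of an additive category C, the two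
canonical composable pairs
  0 → (0 → X1) → (0 → X2) ⊕ (X1 →1 X1) → (X1 →f X2) → 0   and
  0 → (X1 →f X2) → (X2 →1 X2) ⊕ (X1 → 0) → (X2 → 0) → 0
(with the components given in the statement, the middle objects being written via
the canonical identifications 0 ⊕ X1 ≅ X1 and X2 ⊕ 0 ≅ X2) are componentwise
split kernel–cokernel pairs in H(C).
-/

open CategoryTheory CategoryTheory.Limits ZeroObject

namespace Statement2

variable {C : Type*} [Category C] [Preadditive C] [HasFiniteBiproducts C] [HasBinaryBiproducts C]

/-- `(i, p)` is a split short exact sequence in the additive category `C`. -/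
def IsSplitSES {A B X : C} (i : A ⟶ B) (p : B ⟶ X) : Prop :=
  i ≫ p = 0 ∧ ∃ (r : B ⟶ A) (s : X ⟶ B),
    i ≫ r = 𝟙 A ∧ s ≫ p = 𝟙 X ∧ r ≫ i + p ≫ s = 𝟙 B

/-- A componentwise split kernel–cokernel pair in the morphism category `Arrow C`. -/
def IsCwPair {X Z Y : Arrow C} (ι : X ⟶ Z) (π : Z ⟶ Y) : Prop :=
  IsSplitSES ι.left π.left ∧ IsSplitSES ι.right π.right

theorem isSplitSES_zero_id (X : C) : IsSplitSES (0 : (0 : C) ⟶ X) (𝟙 X) :=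
  ⟨by simp, 0, 𝟙 X, (isZero_zero C).eq_of_src _ _, by simp, by simp⟩

theorem isSplitSES_id_zero (X : C) : IsSplitSES (𝟙 X) (0 : X ⟶ (0 : C)) :=
  ⟨by simp, 𝟙 X, 0, by simp, (isZero_zero C).eq_of_src _ _, by simp⟩

theorem isSplitSES_lift_neg_id {X₁ X₂ : C} (f : X₁ ⟶ X₂) :
    IsSplitSES (biprod.lift f (-𝟙 X₁)) (biprod.desc (𝟙 X₂) f) :=
  ⟨by simp, -biprod.snd, biprod.inl, by simp, by simp, by ext <;> simp⟩

theorem isSplitSES_desc_neg_id {X₁ X₂ : C} (f : X₁ ⟶ X₂) :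
    IsSplitSES (biprod.lift f (𝟙 X₁)) (biprod.desc (-𝟙 X₂) f) :=
  ⟨by simp, biprod.snd, -biprod.inl, by simp, by simp, by ext <;> simp⟩

theorem statement2 {X₁ X₂ : C} (f : X₁ ⟶ X₂)
    -- first composable pair: the middle object (0 → X2) ⊕ (X1 →1 X1) is written,
    -- under the identification 0 ⊕ X1 ≅ X1, as (X1 →inr X2 ⊞ X1);
    -- the inflation has components (0, [f, -1]ᵗ):
    (ι₁ : Arrow.mk (0 : (0 : C) ⟶ X₁) ⟶ Arrow.mk (biprod.inr : X₁ ⟶ X₂ ⊞ X₁))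
    (hι₁l : ι₁.left = 0) (hι₁r : ι₁.right = biprod.lift f (-𝟙 X₁))
    -- the deflation has components (1_{X1}, [1, f]):
    (π₁ : Arrow.mk (biprod.inr : X₁ ⟶ X₂ ⊞ X₁) ⟶ Arrow.mk f)
    (hπ₁l : π₁.left = 𝟙 X₁) (hπ₁r : π₁.right = biprod.desc (𝟙 X₂) f)
    -- second composable pair: the middle object (X2 →1 X2) ⊕ (X1 → 0) is written,
    -- under the identification X2 ⊕ 0 ≅ X2, as (X2 ⊞ X1 →fst X2);
    -- the inflation has components ([f, 1]ᵗ, 1_{X2}):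
    (ι₂ : Arrow.mk f ⟶ Arrow.mk (biprod.fst : X₂ ⊞ X₁ ⟶ X₂))
    (hι₂l : ι₂.left = biprod.lift f (𝟙 X₁)) (hι₂r : ι₂.right = 𝟙 X₂)
    -- the deflation has components ([-1, f], 0):
    (π₂ : Arrow.mk (biprod.fst : X₂ ⊞ X₁ ⟶ X₂) ⟶ Arrow.mk (0 : X₂ ⟶ (0 : C)))
    (hπ₂l : π₂.left = biprod.desc (-𝟙 X₂) f) (hπ₂r : π₂.right = 0) :
    IsCwPair ι₁ π₁ ∧ IsCwPair ι₂ π₂ := by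
  refine ⟨⟨?_, ?_⟩, ⟨?_, ?_⟩⟩
  · rw [hι₁l, hπ₁l]
    exact isSplitSES_zero_id X₁
  · rw [hι₁r, hπ₁r]
    exact isSplitSES_lift_neg_id f
  · rw [hι₂l, hπ₂l]
    exact isSplitSES_desc_neg_id f
  · rw [hι₂r, hπ₂r]
    exact isSplitSES_id_zero X₂

end Statement2
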